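/- For every integer t and complex q with |q| < 1, the graded parafermion Verma character admits the bosonic representation V_t(q) = (q;q)_inf^{-3} sum_{j in Z} sum_{i >= 0} (-1)^i q^{C(2j-t,2) + C(i+1,2) + j(i+1)}. -/

import Mathlib

open scoped BigOperators

noncomputable section

/-- Finite q-Pochhammer symbol `(a;q)_n`. -/
def qP (q a : ℂ) (n : ℕ) : ℂ := ∏ m ∈ Finset.range n, (1 - a * q ^ m)

/-- Infinite q-Pochhammer symbol `(a;q)_∞`. -/
def qPInf (q a : ℂ) : ℂ := ∏' m : ℕ, (1 - a * q ^ m)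

/-- `C(n,2) = n(n-1)/2` for `n : ℤ` (exact integer division). -/
def ch2 (n : ℤ) : ℤ := n * (n - 1) / 2

/-- Graded parafermion Verma character `V_t(q)`. -/
def V (q : ℂ) (t : ℤ) : ℂ :=
  (qPInf q q)⁻¹ * ∑' ij : ℕ × ℕ,
    q ^ (ch2 (2 * (ij.2 : ℤ) - 2 * (ij.1 : ℤ) - t) + (ij.2 : ℤ)) *
      ((qP q q ij.1)⁻¹ * (qP q q ij.2)⁻¹)

lemma two_ch2 (n : ℤ) : 2 * ch2 n = n * (n - 1) := by
  unfold ch2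
  refine Int.mul_ediv_cancel' ?_
  have := Int.even_mul_pred_self n
  exact this.two_dvd

lemma norm_zpow_bound (q : ℂ) (hq : ‖q‖ < 1) :
    ∃ ρ : ℝ, 0 < ρ ∧ ρ < 1 ∧ ∀ e : ℤ, ‖q ^ e‖ ≤ ρ ^ e := by
  by_cases h : q = 0
  · refine ⟨1/2, by norm_num, by norm_num, fun e => ?_⟩
    subst h
    by_cases he : e = 0
    · simp [he]
    · rw [zero_zpow _ he, norm_zero]; positivity
  · exact ⟨‖q‖, norm_pos_iff.2 h, hq, fun e => by rw [norm_zpow]⟩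

lemma summ_gen {ι : Type*} (q : ℂ) (hq : ‖q‖ < 1) (w : ι → ℤ)
    (hw : ∀ ρ : ℝ, 0 < ρ → ρ < 1 → Summable fun x => ρ ^ (w x))
    (e : ι → ℤ) (C : ℤ) (he : ∀ x, w x - C ≤ e x) (c : ι → ℂ) (B : ℝ) (hc : ∀ x, ‖c x‖ ≤ B) :
    Summable fun x => c x * q ^ (e x) := by
  obtain ⟨ρ, h0, h1, hb⟩ := norm_zpow_bound q hq
  refine Summable.of_norm_bounded (g := fun x => B * ρ ^ (-C) * ρ ^ (w x)) ((hw ρ h0 h1).mul_left _) ?_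
  intro x
  have hB : 0 ≤ B := (norm_nonneg _).trans (hc x)
  rw [norm_mul, mul_assoc, ← zpow_add₀ h0.ne']
  refine mul_le_mul (hc x) ((hb _).trans ?_) (norm_nonneg _) hB
  refine zpow_le_zpow_right_of_le_one₀ h0 h1.le ?_
  have := he x
  linarith

lemma hw_nat (ρ : ℝ) (h0 : 0 < ρ) (h1 : ρ < 1) : Summable fun x : ℕ => ρ ^ (x : ℤ) := by
  simpa using summable_geometric_of_lt_one h0.le h1

lemma hw_int (ρ : ℝ) (h0 : 0 < ρ) (h1 : ρ < 1) : Summable fun x : ℤ => ρ ^ |x| := by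
  rw [summable_int_iff_summable_nat_and_neg]
  simpa using summable_geometric_of_lt_one h0.le h1

lemma hw_nn (ρ : ℝ) (h0 : 0 < ρ) (h1 : ρ < 1) :
    Summable fun x : ℕ × ℕ => ρ ^ ((x.1 : ℤ) + x.2) := by
  have := (hw_nat ρ h0 h1).mul_of_nonneg (hw_nat ρ h0 h1) (fun _ => by positivity)
    (fun _ => by positivity)
  refine this.congr fun x => ?_
  rw [zpow_add₀ h0.ne']

lemma hw_zn (ρ : ℝ) (h0 : 0 < ρ) (h1 : ρ < 1) :
    Summable fun x : ℤ × ℕ => ρ ^ (|x.1| + x.2) := by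
  have := (hw_int ρ h0 h1).mul_of_nonneg (hw_nat ρ h0 h1) (fun _ => by positivity)
    (fun _ => by positivity)
  refine this.congr fun x => ?_
  rw [zpow_add₀ h0.ne']

lemma one_sub_ne (q : ℂ) (hq : ‖q‖ < 1) (m : ℕ) : 1 - q * q ^ m ≠ 0 := by
  intro h
  have h2 : q ^ (m+1) = 1 := by rw [pow_succ']; linear_combination -h
  have h3 : ‖q‖ ^ (m+1) = 1 := by rw [← norm_pow, h2, norm_one]
  have := pow_lt_one₀ (norm_nonneg q) hq (Nat.succ_ne_zero m)
  simp only [Nat.succ_eq_add_one] at this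
  linarith

lemma qP_ne (q : ℂ) (hq : ‖q‖ < 1) (n : ℕ) : qP q q n ≠ 0 :=
  Finset.prod_ne_zero_iff.2 fun m _ => one_sub_ne q hq m

lemma qP_succ (q : ℂ) (n : ℕ) : qP q q (n+1) = qP q q n * (1 - q ^ (n+1)) := by
  unfold qP
  rw [Finset.prod_range_succ, pow_succ']

lemma qP_zero (q : ℂ) : qP q q 0 = 1 := by simp [qP]

lemma summ_aux (q : ℂ) (hq : ‖q‖ < 1) : Summable fun m : ℕ => ‖-(q * q ^ m)‖ := by
  simp only [norm_neg, norm_mul, norm_pow]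
  exact (summable_geometric_of_lt_one (norm_nonneg _) hq).mul_left _

lemma qPInf_ne (q : ℂ) (hq : ‖q‖ < 1) : qPInf q q ≠ 0 := by
  have := tprod_one_add_ne_zero_of_summable (f := fun m : ℕ => -(q * q ^ m))
    (fun i => by rw [← sub_eq_add_neg]; exact one_sub_ne q hq i) (summ_aux q hq)
  simp only [← sub_eq_add_neg] at this
  exact this

lemma qP_tendsto (q : ℂ) (hq : ‖q‖ < 1) :
    Filter.Tendsto (qP q q) Filter.atTop (nhds (qPInf q q)) := by
  have := (multipliable_one_add_of_summable (summ_aux q hq)).tendsto_prod_tprod_nat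
  simp only [← sub_eq_add_neg] at this
  exact this

lemma inv_bdd (q : ℂ) (hq : ‖q‖ < 1) : ∃ B : ℝ, ∀ n, ‖(qP q q n)⁻¹‖ ≤ B := by
  have := ((qP_tendsto q hq).inv₀ (qPInf_ne q hq)).norm.bddAbove_range
  obtain ⟨B, hB⟩ := this
  exact ⟨B, fun n => hB ⟨n, rfl⟩⟩

/-- Dominated convergence: only the zeroth term survives. -/
lemma lim_aux (q : ℂ) (hq : ‖q‖ < 1) (c : ℕ → ℂ) (B : ℝ) (hc : ∀ n, ‖c n‖ ≤ B) (h0 : c 0 = 1) :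
    Filter.Tendsto (fun m : ℕ => ∑' n : ℕ, c n * q ^ ((m+1) * n)) Filter.atTop (nhds 1) := by
  have h1 : (1 : ℂ) = ∑' n : ℕ, if n = 0 then (1 : ℂ) else 0 := by simp
  rw [h1]
  refine tendsto_tsum_of_dominated_convergence (bound := fun n => B * ‖q‖ ^ n)
    ((summable_geometric_of_lt_one (norm_nonneg _) hq).mul_left _) ?_ ?_
  · intro n
    by_cases hn : n = 0
    · subst hn; simp [h0]
    · simp only [hn, if_false]
      have h2 : Filter.Tendsto (fun m : ℕ => (q ^ n) ^ (m+1)) Filter.atTop (nhds 0) := by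
        refine (Filter.tendsto_add_atTop_iff_nat 1).2 ?_
        apply tendsto_pow_atTop_nhds_zero_of_norm_lt_one
        rw [norm_pow]
        exact pow_lt_one₀ (norm_nonneg q) hq hn
      have := h2.const_mul (c n)
      simp only [mul_zero] at this
      refine this.congr fun m => ?_
      rw [← pow_mul, mul_comm n]
  · refine Filter.Eventually.of_forall fun m n => ?_
    rw [norm_mul, norm_pow]
    have hB : 0 ≤ B := (norm_nonneg _).trans (hc n)
    refine mul_le_mul (hc n) ?_ (by positivity) hB
    refine pow_le_pow_of_le_one (norm_nonneg _) hq.le ?_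
    nlinarith

/-- First Euler identity at powers of `q`. -/
lemma euler1 (q : ℂ) (hq : ‖q‖ < 1) (m : ℕ) :
    ∑' n : ℕ, (qP q q n)⁻¹ * q ^ ((m+1) * n) = qP q q m * (qPInf q q)⁻¹ := by
  obtain ⟨B, hB⟩ := inv_bdd q hq
  have hs : ∀ m : ℕ, Summable fun n : ℕ => (qP q q n)⁻¹ * q ^ ((m+1) * n) := by
    intro m
    have := summ_gen q hq (fun n : ℕ => (n : ℤ)) hw_nat (fun n : ℕ => (((m+1) * n : ℕ) : ℤ)) 0
      (fun n => by push_cast; nlinarith) (fun n => (qP q q n)⁻¹) B hB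
    simpa only [zpow_natCast] using this
  set S : ℕ → ℂ := fun m => ∑' n : ℕ, (qP q q n)⁻¹ * q ^ ((m+1) * n) with hS
  have rec1 : ∀ m, S (m+1) = (1 - q ^ (m+1)) * S m := by
    intro m
    have e1 : S m - S (m+1) = q ^ (m+1) * S m := by
      simp only [hS]
      rw [← (hs m).tsum_sub (hs (m+1)), ((hs m).sub (hs (m+1))).tsum_eq_zero_add, ← tsum_mul_left]
      simp only [mul_zero, pow_zero, sub_self, zero_add]
      congr 1; ext n
      have h1 := qP_ne q hq n
      have h2 := qP_ne q hq (n+1)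
      have h3 : (1 - q ^ (n+1)) ≠ 0 := by have := one_sub_ne q hq n; rwa [pow_succ']
      rw [qP_succ, mul_inv]
      have e : q ^ ((m + 1 + 1) * (n+1)) = q ^ ((m+1) * (n+1)) * q ^ (n+1) := by
        rw [← pow_add]; congr 1; ring
      have e2 : q ^ ((m + 1) * (n+1)) = q ^ ((m+1) * n) * q ^ (m+1) := by
        rw [← pow_add]; congr 1
      rw [e, e2]
      field_simp
    linear_combination -e1
  have h1 : ∀ m, S m = qP q q m * S 0 := by
    intro m
    induction m with
    | zero => simp [qP_zero]
    | succ m ih => rw [rec1, ih, qP_succ]; ring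
  have l1 : Filter.Tendsto S Filter.atTop (nhds 1) :=
    lim_aux q hq (fun n => (qP q q n)⁻¹) B hB (by simp [qP_zero])
  have l2 : Filter.Tendsto S Filter.atTop (nhds (qPInf q q * S 0)) :=
    ((qP_tendsto q hq).mul_const (S 0)).congr fun m => (h1 m).symm
  have h2 := tendsto_nhds_unique l1 l2
  have h3 : S 0 = (qPInf q q)⁻¹ := eq_inv_of_mul_eq_one_right h2.symm
  have := h1 m
  rw [h3] at this
  exact this

lemma ch2_nat_succ (n : ℕ) : ch2 ((n : ℤ) + 1) = ch2 n + n := by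
  have h1 := two_ch2 n
  have h2 := two_ch2 (n + 1)
  have : 2 * ch2 ((n : ℤ) + 1) = 2 * (ch2 n + n) := by linear_combination h2 - h1
  linarith

lemma ch2_nat_nonneg (n : ℤ) : 0 ≤ ch2 n := by
  have h1 := two_ch2 n
  have : 0 ≤ n * (n - 1) := by
    rcases le_or_gt n 0 with h | h
    · nlinarith
    · nlinarith
  linarith

/-- Second Euler identity at integer powers of `q`. -/
lemma euler2 (q : ℂ) (hq : ‖q‖ < 1) (h0 : q ≠ 0) (m : ℤ) :
    (∑' n : ℕ, ((-1 : ℂ) ^ n * (qP q q n)⁻¹) * q ^ (ch2 n + n * (m + 1)))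
      = if 0 ≤ m then qPInf q q * (qP q q m.toNat)⁻¹ else 0 := by
  obtain ⟨B, hB⟩ := inv_bdd q hq
  have hB' : ∀ n : ℕ, ‖(-1 : ℂ) ^ n * (qP q q n)⁻¹‖ ≤ B := by
    intro n; simpa using hB n
  have hs : ∀ m : ℤ, Summable fun n : ℕ =>
      ((-1 : ℂ) ^ n * (qP q q n)⁻¹) * q ^ (ch2 n + n * m) := by
    intro m
    refine summ_gen q hq (fun n : ℕ => (n : ℤ)) hw_nat (fun n : ℕ => ch2 n + n * m) ((2*m-3)^2)
      (fun n => ?_) _ B hB'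
    have := two_ch2 n
    nlinarith [sq_nonneg ((n : ℤ) + (2*m-3)), sq_nonneg (n : ℤ), sq_nonneg (2*m-3)]
  set T : ℤ → ℂ := fun m => ∑' n : ℕ,
      ((-1 : ℂ) ^ n * (qP q q n)⁻¹) * q ^ (ch2 n + n * m) with hT
  have rec1 : ∀ m, T m = (1 - q ^ m) * T (m + 1) := by
    intro m
    have e1 : T m - T (m+1) = - q ^ m * T (m + 1) := by
      simp only [hT]
      rw [← (hs m).tsum_sub (hs (m+1)), ((hs m).sub (hs (m+1))).tsum_eq_zero_add, ← tsum_mul_left]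
      simp only [Nat.cast_zero, zero_mul, sub_self, zero_add]
      congr 1; ext n
      have h1 := qP_ne q hq n
      have h3 : (1 - q ^ (n+1)) ≠ 0 := by have := one_sub_ne q hq n; rwa [pow_succ']
      rw [qP_succ, mul_inv]
      push_cast
      rw [ch2_nat_succ]
      have e : q ^ (ch2 n + n + ((n:ℤ)+1) * (m+1))
          = q ^ (ch2 n + (n:ℤ) * (m+1)) * q ^ m * q ^ (n+1) := by
        rw [← zpow_natCast q (n+1), ← zpow_add₀ h0, ← zpow_add₀ h0]; congr 1; push_cast; ring
      have e2 : q ^ (ch2 n + n + ((n:ℤ)+1) * m)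
          = q ^ (ch2 n + (n:ℤ) * (m+1)) * q ^ m := by
        rw [← zpow_add₀ h0]; congr 1; ring
      rw [e, e2]
      field_simp
      ring
    linear_combination e1
  have hneg : ∀ k : ℕ, T (-k) = 0 := by
    intro k
    induction k with
    | zero => rw [rec1]; simp
    | succ k ih =>
      rw [rec1]
      have : (-((k + 1 : ℕ) : ℤ) + 1) = -k := by push_cast; ring
      rw [this, ih, mul_zero]
  have h1 : ∀ m : ℕ, qP q q m * T (m + 1) = T 1 := by
    intro m
    induction m with
    | zero => simp [qP_zero]
    | succ m ih =>
      rw [← ih, rec1 (m + 1), qP_succ]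
      push_cast
      have : q ^ ((m : ℤ) + 1) = q ^ (m+1) := by exact_mod_cast zpow_natCast q (m+1)
      rw [this]; ring
  have l1 : Filter.Tendsto (fun m : ℕ => T (m+1)) Filter.atTop (nhds 1) := by
    have := lim_aux q hq (fun n => ((-1 : ℂ) ^ n * (qP q q n)⁻¹) * q ^ (ch2 n)) B ?_ ?_
    · refine this.congr fun m => ?_
      simp only [hT]
      congr 1; ext n
      rw [zpow_add₀ h0, mul_assoc _ (q ^ (ch2 n)), ← zpow_natCast q ((m+1)*n)]
      congr 3
      push_cast; ring
    · intro n
      rw [norm_mul]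
      refine (mul_le_mul (hB' n) ?_ (norm_nonneg _) ((norm_nonneg _).trans (hB' n))).trans
        (mul_one B).le
      rw [norm_zpow]
      exact zpow_le_one₀ (norm_pos_iff.2 h0) hq.le (ch2_nat_nonneg n)
    · simp [qP_zero, ch2]
  have l2 := (qP_tendsto q hq).mul l1
  rw [mul_one] at l2
  have l3 : Filter.Tendsto (fun m : ℕ => qP q q m * T (m+1)) Filter.atTop (nhds (T 1)) := by
    simp only [h1]; exact tendsto_const_nhds
  have h2 := tendsto_nhds_unique l2 l3
  change T (m + 1) = _
  split_ifs with hm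
  · lift m to ℕ using hm
    have := h1 m
    rw [← h2] at this
    have h3 := qP_ne q hq m
    simp only [Int.toNat_natCast]
    field_simp
    linear_combination this
  · obtain ⟨k, hk⟩ := Int.eq_ofNat_of_zero_le (show 0 ≤ -(m+1) by omega)
    have : m + 1 = -(k : ℤ) := by omega
    rw [this, hneg]

/-- the summand after reindexing `k = j - i` -/
def G (q : ℂ) (c : ℤ) (k : ℤ) (i : ℕ) : ℂ :=
  (if 0 ≤ (i : ℤ) + k then (qP q q i)⁻¹ * (qP q q ((i : ℤ) + k).toNat)⁻¹ else 0)
    * q ^ (c + ((i : ℤ) + k))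

lemma inner_ne (q : ℂ) (hq : ‖q‖ < 1) (h0 : q ≠ 0) (c k : ℤ) :
    ∑' i : ℕ, G q c k i = ((qPInf q q)⁻¹) ^ 2 *
      ∑' n : ℕ, (-1 : ℂ) ^ n * q ^ (c + ch2 ((n : ℤ) + 1) + k * ((n : ℤ) + 1)) := by
  obtain ⟨B, hB⟩ := inv_bdd q hq
  have hQ := qPInf_ne q hq
  set F : ℕ → ℕ → ℂ := fun i n =>
    ((-1 : ℂ) ^ n * (qP q q n)⁻¹ * (qP q q i)⁻¹) *
      q ^ (ch2 n + n * ((i : ℤ) + k + 1) + (c + (i + k))) with hF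
  have hsF : Summable (Function.uncurry F) := by
    refine summ_gen q hq (fun x : ℕ × ℕ => (x.1 : ℤ) + x.2) hw_nn
      (fun x => ch2 x.2 + x.2 * ((x.1 : ℤ) + k + 1) + (c + (x.1 + k))) ((2*k-1)^2 + |c| + |k|)
      (fun x => ?_) (fun x => (-1 : ℂ) ^ x.2 * (qP q q x.2)⁻¹ * (qP q q x.1)⁻¹) (B * B) (fun x => ?_)
    · have h1 := two_ch2 x.2
      have h2 : (0 : ℤ) ≤ x.2 * x.1 := by positivity
      have h3 := neg_abs_le c
      have h4 := neg_abs_le k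
      nlinarith [sq_nonneg ((x.2 : ℤ) + (2*k-1)), sq_nonneg (x.2 : ℤ), sq_nonneg (2*k-1)]
    · rw [norm_mul]
      refine mul_le_mul ?_ (hB _) (norm_nonneg _) ((norm_nonneg _).trans (hB 0))
      simpa using hB x.2
  have s1 : ∀ i : ℕ, G q c k i = (qPInf q q)⁻¹ * ∑' n : ℕ, F i n := by
    intro i
    have e := euler2 q hq h0 ((i : ℤ) + k)
    have e2 : ∑' n : ℕ, F i n = ((qP q q i)⁻¹ * q ^ (c + ((i : ℤ) + k))) *
        ∑' n : ℕ, ((-1 : ℂ) ^ n * (qP q q n)⁻¹) * q ^ (ch2 n + n * ((i : ℤ) + k + 1)) := by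
      rw [← tsum_mul_left]
      congr 1; ext n
      simp only [hF]
      rw [zpow_add₀ h0 (ch2 n + n * ((i : ℤ) + k + 1))]
      ring
    rw [e2, e]
    unfold G
    split_ifs with h
    · field_simp
    · simp
  have s2 : ∀ n : ℕ, ∑' i : ℕ, F i n = (qPInf q q)⁻¹ *
      ((-1 : ℂ) ^ n * q ^ (c + ch2 ((n : ℤ) + 1) + k * ((n : ℤ) + 1))) := by
    intro n
    have e := euler1 q hq n
    have e2 : ∑' i : ℕ, F i n = ((-1 : ℂ) ^ n * (qP q q n)⁻¹ *
        q ^ (c + ch2 ((n : ℤ) + 1) + k * ((n : ℤ) + 1))) *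
        ∑' i : ℕ, (qP q q i)⁻¹ * q ^ ((n+1) * i) := by
      rw [← tsum_mul_left]
      congr 1; ext i
      simp only [hF]
      have : q ^ (ch2 n + n * ((i : ℤ) + k + 1) + (c + (i + k)))
          = q ^ (c + ch2 ((n : ℤ) + 1) + k * ((n : ℤ) + 1)) * q ^ ((n+1) * i) := by
        rw [← zpow_natCast q ((n+1)*i), ← zpow_add₀ h0, ch2_nat_succ]
        congr 1; push_cast; ring
      rw [this]; ring
    rw [e2, e]
    have h1 := qP_ne q hq n
    field_simp
  simp only [s1]
  rw [tsum_mul_left, ← hsF.tsum_comm]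
  simp only [s2]
  rw [tsum_mul_left]
  ring

lemma bos_bound (t j i : ℤ) (hi : 0 ≤ i) :
    |j| + i - (100 * t ^ 2 + 100) ≤ ch2 (2 * j - t) + ch2 (i + 1) + j * (i + 1) := by
  have h1 := two_ch2 (2 * j - t)
  have h2 := two_ch2 (i + 1)
  rcases abs_cases j with ⟨h, _⟩ | ⟨h, _⟩ <;> rw [h] <;>
  nlinarith [sq_nonneg (i + j - 1), sq_nonneg (i + j), sq_nonneg (j - 2 * t), sq_nonneg (j - 1),
    sq_nonneg (j + 1), sq_nonneg (j-2), sq_nonneg t, sq_nonneg (t - 1), sq_nonneg (t+1),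
    sq_nonneg (j-3), sq_nonneg (j+3), sq_nonneg (i + j - 2)]

lemma bos_summable (q : ℂ) (hq : ‖q‖ < 1) (t : ℤ) : Summable fun x : ℤ × ℕ =>
    (-1 : ℂ) ^ x.2 * q ^ (ch2 (2 * x.1 - t) + ch2 ((x.2 : ℤ) + 1) + x.1 * ((x.2 : ℤ) + 1)) :=
  summ_gen q hq (fun x : ℤ × ℕ => |x.1| + x.2) hw_zn _ (100 * t ^ 2 + 100)
    (fun x => bos_bound t x.1 x.2 (by positivity)) (fun x => (-1 : ℂ) ^ x.2) 1
    (fun x => by simp)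

lemma G_summable (q : ℂ) (hq : ‖q‖ < 1) (t : ℤ) : Summable fun x : ℤ × ℕ =>
    G q (ch2 (2 * x.1 - t)) x.1 x.2 := by
  obtain ⟨B, hB⟩ := inv_bdd q hq
  have hB0 : 0 ≤ B := (norm_nonneg _).trans (hB 0)
  refine summ_gen q hq (fun x : ℤ × ℕ => |x.1| + x.2) hw_zn
    (fun x => ch2 (2 * x.1 - t) + ((x.2 : ℤ) + x.1)) (100 * t ^ 2 + 100)
    (fun x => ?_) (fun x : ℤ × ℕ => if 0 ≤ (x.2 : ℤ) + x.1 then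
      (qP q q x.2)⁻¹ * (qP q q ((x.2 : ℤ) + x.1).toNat)⁻¹ else 0) (B * B)
    (fun x => ?_)
  · obtain ⟨j, i⟩ := x
    have h1 := two_ch2 (2 * j - t)
    simp only
    rcases abs_cases j with ⟨h, _⟩ | ⟨h, _⟩ <;> rw [h] <;>
    nlinarith [sq_nonneg (j - 2 * t), sq_nonneg (j - 1),
      sq_nonneg (j + 1), sq_nonneg t, sq_nonneg (t - 1), sq_nonneg (t+1),
      sq_nonneg (j-3), sq_nonneg (j+3)]
  · split_ifs
    · rw [norm_mul]
      exact mul_le_mul (hB _) (hB _) (norm_nonneg _) hB0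
    · simp; positivity

lemma inner_zero_pos (c k : ℤ) (hc : 0 ≤ c) (hk : 0 < k) :
    ∑' i : ℕ, G 0 c k i =
      ∑' n : ℕ, (-1 : ℂ) ^ n * 0 ^ (c + ch2 ((n : ℤ) + 1) + k * ((n : ℤ) + 1)) := by
  have h1 : ∀ i : ℕ, G 0 c k i = 0 := by
    intro i
    unfold G
    rw [zero_zpow _ (by omega), mul_zero]
  have h2 : ∀ n : ℕ, (0 : ℂ) ^ (c + ch2 ((n : ℤ) + 1) + k * ((n : ℤ) + 1)) = 0 := by
    intro n
    apply zero_zpow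
    have := ch2_nat_nonneg ((n : ℤ) + 1)
    have : 0 < k * ((n : ℤ) + 1) := by positivity
    omega
  simp [h1, h2]

lemma inner_zero_neg (c : ℤ) (k : ℕ) (hc : 0 ≤ c)
    (hs : Summable fun n : ℕ => (-1 : ℂ) ^ n *
      0 ^ (c + ch2 ((n : ℤ) + 1) + (-(k : ℤ)) * ((n : ℤ) + 1))) :
    ∑' i : ℕ, G 0 c (-(k : ℤ)) i =
      ∑' n : ℕ, (-1 : ℂ) ^ n * 0 ^ (c + ch2 ((n : ℤ) + 1) + (-(k : ℤ)) * ((n : ℤ) + 1)) := by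
  have hP : ∀ n, qP 0 0 n = 1 := by intro n; simp [qP]
  have hL : ∑' i : ℕ, G 0 c (-(k : ℤ)) i = (0 : ℂ) ^ c := by
    rw [tsum_eq_single k]
    · simp [G, hP]
    · intro i hi
      unfold G
      split_ifs with h
      · rw [zero_zpow _ (by omega), mul_zero]
      · simp
  rw [hL, ← hs.sum_add_tsum_nat_add (2 * k)]
  set f : ℕ → ℂ := fun n => (-1 : ℂ) ^ n *
      0 ^ (c + ch2 ((n : ℤ) + 1) + (-(k : ℤ)) * ((n : ℤ) + 1)) with hf
  have e1 : ∑ n ∈ Finset.range (2 * k), f n = 0 := by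
    have h := Finset.sum_range_reflect f (2 * k)
    have h' : ∑ n ∈ Finset.range (2 * k), f (2 * k - 1 - n) =
        - ∑ n ∈ Finset.range (2 * k), f n := by
      rw [← Finset.sum_neg_distrib]
      refine Finset.sum_congr rfl fun n hn => ?_
      have hn := Finset.mem_range.1 hn
      obtain ⟨m, hm⟩ : ∃ m, m = 2 * k - 1 - n := ⟨_, rfl⟩
      rw [← hm]
      have hmn : m + n + 1 = 2 * k := by omega
      simp only [hf]
      have s : (-1 : ℂ) ^ m = - (-1 : ℂ) ^ n := by
        have a : (-1 : ℂ) ^ m * (-1) ^ n = -1 := by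
          have : (-1 : ℂ) ^ (m + n + 1) = 1 := by rw [hmn, pow_mul]; simp
          rw [pow_succ, pow_add] at this
          linear_combination -this
        have b : (-1 : ℂ) ^ n * (-1) ^ n = 1 := by
          rw [← mul_pow]; simp
        linear_combination (-1 : ℂ) ^ n * a - (-1 : ℂ) ^ m * b
      have x : c + ch2 ((m : ℤ) + 1) + (-(k : ℤ)) * ((m : ℤ) + 1)
          = c + ch2 ((n : ℤ) + 1) + (-(k : ℤ)) * ((n : ℤ) + 1) := by
        have a1 := two_ch2 ((m : ℤ) + 1)
        have a2 := two_ch2 ((n : ℤ) + 1)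
        have a3 : (m : ℤ) = 2 * k - n - 1 := by omega
        rw [a3] at a1 ⊢
        have : 2 * (ch2 (2 * (k : ℤ) - n - 1 + 1) + (-(k : ℤ)) * ((2 * k - n - 1) + 1)) =
          2 * (ch2 ((n : ℤ) + 1) + (-(k : ℤ)) * ((n : ℤ) + 1)) := by
          linear_combination a1 - a2
        linarith
      rw [s, x]; ring
    have h2 : (2 : ℂ) * ∑ n ∈ Finset.range (2 * k), f n = 0 := by linear_combination h' - h
    simpa using h2
  have x : ∀ n : ℕ, 2 * (ch2 (((n + 2 * k : ℕ) : ℤ) + 1) +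
      (-(k : ℤ)) * (((n + 2 * k : ℕ) : ℤ) + 1)) = n * (n + 2 * k + 1) := by
    intro n
    have a1 := two_ch2 (((n + 2 * k : ℕ) : ℤ) + 1)
    push_cast at a1 ⊢
    linear_combination a1
  rw [e1, zero_add, tsum_eq_single 0]
  · have := x 0
    have y : c + ch2 (((0 + 2 * k : ℕ) : ℤ) + 1) +
      (-(k : ℤ)) * (((0 + 2 * k : ℕ) : ℤ) + 1) = c := by
      rw [Nat.cast_zero, zero_mul] at this; linarith
    rw [y, zero_add, pow_mul]; simp
  · intro n hn
    rw [zero_zpow, mul_zero]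
    have := x n
    have : 0 < (n : ℤ) * (n + 2 * k + 1) := by positivity
    linarith

lemma inner_all (q : ℂ) (hq : ‖q‖ < 1) (t k : ℤ) :
    ∑' i : ℕ, G q (ch2 (2 * k - t)) k i = ((qPInf q q)⁻¹) ^ 2 *
      ∑' n : ℕ, (-1 : ℂ) ^ n *
        q ^ (ch2 (2 * k - t) + ch2 ((n : ℤ) + 1) + k * ((n : ℤ) + 1)) := by
  by_cases h0 : q = 0
  · subst h0
    have hQ : qPInf 0 0 = 1 := by simp [qPInf]
    rw [hQ, inv_one, one_pow, one_mul]
    rcases lt_or_ge 0 k with hk | hk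
    · exact inner_zero_pos _ k (ch2_nat_nonneg _) hk
    · obtain ⟨m, hm⟩ := Int.eq_ofNat_of_zero_le (show 0 ≤ -k by omega)
      obtain rfl : k = -(m : ℤ) := by omega
      exact inner_zero_neg _ m (ch2_nat_nonneg _) ((bos_summable 0 hq t).prod_factor (-(m : ℤ)))
  · exact inner_ne q hq h0 _ k

/-- Bosonic form of the graded parafermion Verma character. -/
theorem graded_verma_bosonic (t : ℤ) (q : ℂ) (hq : ‖q‖ < 1) :
    V q t = ((qPInf q q)⁻¹) ^ 3 *
      ∑' x : ℤ × ℕ,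
        (-1 : ℂ) ^ x.2 *
          q ^ (ch2 (2 * x.1 - t) + ch2 ((x.2 : ℤ) + 1) + x.1 * ((x.2 : ℤ) + 1)) := by
  unfold V
  set g : ℕ × ℕ → ℤ × ℕ := fun ij => ((ij.2 : ℤ) - ij.1, ij.1) with hg
  have hinj : Function.Injective g := by
    rintro ⟨a, b⟩ ⟨a', b'⟩ h
    simp only [hg, Prod.mk.injEq] at h
    ext <;> simp <;> omega
  have key := hinj.tsum_eq (f := fun x : ℤ × ℕ => G q (ch2 (2 * x.1 - t)) x.1 x.2) (by
    rintro ⟨k, i⟩ hx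
    by_cases h : 0 ≤ (i : ℤ) + k
    · refine ⟨(i, ((i : ℤ) + k).toNat), ?_⟩
      simp only [hg, Prod.mk.injEq, and_true]
      omega
    · exfalso; apply hx; simp [G, h])
  have e : ∀ ij : ℕ × ℕ, q ^ (ch2 (2 * (ij.2 : ℤ) - 2 * (ij.1 : ℤ) - t) + (ij.2 : ℤ)) *
      ((qP q q ij.1)⁻¹ * (qP q q ij.2)⁻¹) = G q (ch2 (2 * (g ij).1 - t)) (g ij).1 (g ij).2 := by
    rintro ⟨i, j⟩
    have h1 : (i : ℤ) + ((j : ℤ) - i) = j := by ring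
    simp only [hg, G, h1, Int.toNat_natCast, Int.natCast_nonneg, if_true]
    rw [mul_comm, mul_sub]
  simp only [e]
  rw [key, (G_summable q hq t).tsum_prod, (bos_summable q hq t).tsum_prod]
  simp only [inner_all q hq t]
  rw [tsum_mul_left]
  ring
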